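/- Let d≥2, β>0, μ>0, γ>-1, α=β+μ+(d-1)/2, n∈ℕ₀, and let (x,t),(y,s)∈𝕍^{d+1} with t,s>0. Then P_n(W_{β,γ,μ};(x,t),(y,s)) = κ_β·∫_{[-1,1]³} P_n(U_{γ,α};(√t,t),(√s·ξ(x,t,y,s;z,u), s))·(1-z₁)^{μ+(d-1)/2}(1+z₁)^{β-1}(1-z₂²)^{β-1/2}(1-u²)^{μ-1} dz₁ dz₂ du, where ξ(x,t,y,s;z,u) = ((1-z₁)/2)·ξ₀(x,t,y,s;u) + ((1+z₁)/2)·z₂ and κ_β = (∫_{[-1,1]³} (1-z₁)^{μ+(d-1)/2}(1+z₁)^{β-1}(1-z₂²)^{β-1/2}(1-u²)^{μ-1} dz₁ dz₂ du)^{-1}. -/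

import Mathlib

open MeasureTheory Real Filter Set
open scoped RealInnerProductSpace ENNReal

noncomputable section

/-- Pochhammer symbol `(a)_n = a(a+1)⋯(a+n-1)`. -/
def poch (a : ℝ) (n : ℕ) : ℝ := ∏ i ∈ Finset.range n, (a + i)

/-- Jacobi polynomial `P_n^{(a,b)}(t)` via its hypergeometric expansion. -/
def jacobiP (n : ℕ) (a b : ℝ) (t : ℝ) : ℝ :=
  (poch (a + 1) n / (n.factorial : ℝ)) *
    ∑ j ∈ Finset.range (n + 1),
      (poch (-(n : ℝ)) j * poch ((n : ℝ) + a + b + 1) j) /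
        (poch (a + 1) j * (j.factorial : ℝ)) * ((1 - t) / 2) ^ j

/-- Squared norm `h_n^{(a,b)}` of the Jacobi polynomials. -/
def hJ (n : ℕ) (a b : ℝ) : ℝ :=
  (poch (a + 1) n * poch (b + 1) n * (a + b + (n : ℝ) + 1)) /
    ((n.factorial : ℝ) * poch (a + b + 2) n * (a + b + 2 * (n : ℝ) + 1))

/-- Normalization constant `c_{a,b}` of the Jacobi weight. -/
def cJ (a b : ℝ) : ℝ := Real.Gamma (a + b + 2) / (Real.Gamma (a + 1) * Real.Gamma (b + 1))

/-- Generalized binomial coefficient `C(n+δ, n) = (δ+1)_n/n!`. -/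
def binomC (δ : ℝ) (n : ℕ) : ℝ := poch (δ + 1) n / (n.factorial : ℝ)

/-- The parabolic domain `𝕌 = {(x₁,x₂) : x₁² ≤ x₂ ≤ 1}`. -/
def Udom : Set (ℝ × ℝ) := {x | x.1 ^ 2 ≤ x.2 ∧ x.2 ≤ 1}

/-- The curved part `𝕌₀` of the boundary of `𝕌`. -/
def Udom0 : Set (ℝ × ℝ) := {x ∈ Udom | x.2 = x.1 ^ 2}

/-- The weight `U_{a,b}` on the parabolic domain. -/
def Uw (a b : ℝ) (x : ℝ × ℝ) : ℝ := (1 - x.2) ^ a * (x.2 - x.1 ^ 2) ^ (b - 1/2)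

/-- Normalization constant `d_{a,b}` of `U_{a,b}`. -/
def dU (a b : ℝ) : ℝ := (∫ x in Udom, Uw a b x)⁻¹

/-- The weighted measure `U_{a,b}(x) dx` on `𝕌`. -/
def μU (a b : ℝ) : Measure (ℝ × ℝ) :=
  (volume.restrict Udom).withDensity fun x => ENNReal.ofReal (Uw a b x)

/-- The orthogonal basis `P_{k,n}^{a,b}` on the parabolic domain (with the continuous
extension to `x₂ = 0`, where in Lean `x₁/√x₂ = 0` and `(√x₂)^k = 0` for `k ≥ 1`). -/
def PknU (a b : ℝ) (k n : ℕ) (x : ℝ × ℝ) : ℝ :=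
  jacobiP (n - k) (b + (k : ℝ)) a (1 - 2 * x.2) * (Real.sqrt x.2) ^ k *
    jacobiP k (b - 1/2) (b - 1/2) (x.1 / Real.sqrt x.2)

/-- Squared norms `h_{k,n}^{a,b}`. -/
def hknU (a b : ℝ) (k n : ℕ) : ℝ :=
  (cJ b a / cJ (b + (k : ℝ)) a) * hJ (n - k) (b + (k : ℝ)) a * hJ k (b - 1/2) (b - 1/2)

/-- Reproducing kernel `P_n(U_{a,b}; x, y)` on the parabolic domain. -/
def PnU (a b : ℝ) (n : ℕ) (x y : ℝ × ℝ) : ℝ :=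
  ∑ k ∈ Finset.range (n + 1), PknU a b k n x * PknU a b k n y / hknU a b k n

/-- Partial-sum kernel `K_n(U_{a,b}; x, y)`. -/
def KnU (a b : ℝ) (n : ℕ) (x y : ℝ × ℝ) : ℝ :=
  ∑ m ∈ Finset.range (n + 1), PnU a b m x y

/-- Cesàro `(C,δ)` kernel `K_n^δ(U_{a,b}; x, y)`. -/
def KnUCes (a b δ : ℝ) (n : ℕ) (x y : ℝ × ℝ) : ℝ :=
  (binomC δ n)⁻¹ * ∑ m ∈ Finset.range (n + 1), binomC (δ - 1) (n - m) * KnU a b m x y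

/-- Cesàro `(C,δ)` means `S_n^δ(U_{a,b}; f, x)`. -/
def SnUCes (a b δ : ℝ) (n : ℕ) (f : ℝ × ℝ → ℝ) (x : ℝ × ℝ) : ℝ :=
  dU a b * ∫ y in Udom, f y * KnUCes a b δ n x y * Uw a b y

/-- `Z_m^λ`, the normalized Gegenbauer polynomial (`2T_m` in the limiting case `λ = 0`). -/
def Zm (lam : ℝ) (m : ℕ) (t : ℝ) : ℝ :=
  if lam = 0 then (if m = 0 then 1 else 2 * (Polynomial.Chebyshev.T ℝ (m : ℤ)).eval t)
  else ((m : ℝ) + lam) / lam * (poch (2 * lam) m / poch (lam + 1/2) m) *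
    jacobiP m (lam - 1/2) (lam - 1/2) t

/-- Euclidean space `ℝ^d`. -/
abbrev Euc (d : ℕ) := EuclideanSpace ℝ (Fin d)

/-- The surface measure on the unit sphere `𝕊^{d-1}`. -/
def sphMeas (d : ℕ) : Measure (Metric.sphere (0 : Euc d) 1) :=
  (volume : Measure (Euc d)).toSphere

/-- The surface area `ω_d` of the unit sphere. -/
def ωd (d : ℕ) : ℝ := (sphMeas d Set.univ).toReal

/-- Integral over the unit sphere. -/
def sphInt (d : ℕ) (f : Euc d → ℝ) : ℝ := ∫ ξ, f (ξ : Euc d) ∂(sphMeas d)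

/-- Integral over the surface of the paraboloid `𝕍₀^{d+1}`:
`∫_{𝕍₀} f dσ = ∫_0^1 t^{(d-1)/2} ∫_{𝕊^{d-1}} f(√t ξ, t) dσ_𝕊(ξ) dt`. -/
def V0Int (d : ℕ) (f : Euc d → ℝ → ℝ) : ℝ :=
  ∫ t in (0:ℝ)..1, t ^ (((d : ℝ) - 1) / 2) * ∫ ξ, f (Real.sqrt t • (ξ : Euc d)) t ∂(sphMeas d)

/-- The weight `ϖ_{β,γ}(t) = t^β (1-t)^γ`. -/
def wt (β γ : ℝ) (t : ℝ) : ℝ := t ^ β * (1 - t) ^ γ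

/-- Normalization constant `b_{β,γ}` on the surface of the paraboloid. -/
def bV0 (d : ℕ) (β γ : ℝ) : ℝ := (V0Int d fun _ t => wt β γ t)⁻¹

/-- The surface of the paraboloid `𝕍₀^{d+1} = {(x,t) : ‖x‖² = t ≤ 1}`. -/
def V0set (d : ℕ) : Set (Euc d × ℝ) := {q | ‖q.1‖ ^ 2 = q.2 ∧ q.2 ≤ 1}

/-- The weighted measure `ϖ_{β,γ} dσ` on (the sphere-parametrization of) `𝕍₀^{d+1}`. -/
def μV0 (d : ℕ) (β γ : ℝ) : Measure (Metric.sphere (0 : Euc d) 1 × ℝ) :=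
  ((sphMeas d).prod (volume.restrict (Set.Icc (0:ℝ) 1))).withDensity
    fun p => ENNReal.ofReal (p.2 ^ (((d : ℝ) - 1) / 2) * wt β γ p.2)

/-- Squared norms `h_{m,n}^{β,γ}` on the surface of the paraboloid. -/
def hV0 (d : ℕ) (β γ : ℝ) (m n : ℕ) : ℝ :=
  (cJ (β + ((d : ℝ) - 1) / 2) γ / cJ ((m : ℝ) + β + ((d : ℝ) - 1) / 2) γ) *
    hJ (n - m) ((m : ℝ) + β + ((d : ℝ) - 1) / 2) γ

/-- The reproducing kernel `P_n(ϖ_{β,γ}; (√t ξ, t), (√s η, s))` on `𝕍₀^{d+1}`,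
written as a function of `t`, `s` and `c = ⟨ξ,η⟩`. -/
def PnV0 (d : ℕ) (β γ : ℝ) (n : ℕ) (t s c : ℝ) : ℝ :=
  ∑ m ∈ Finset.range (n + 1),
    jacobiP (n - m) ((m : ℝ) + β + ((d : ℝ) - 1) / 2) γ (1 - 2 * t) *
      jacobiP (n - m) ((m : ℝ) + β + ((d : ℝ) - 1) / 2) γ (1 - 2 * s) / hV0 d β γ m n *
      (Real.sqrt t) ^ m * (Real.sqrt s) ^ m * Zm (((d : ℝ) - 2) / 2) m c

/-- Partial-sum kernel `K_n(ϖ_{β,γ})` on `𝕍₀^{d+1}`. -/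
def KnV0 (d : ℕ) (β γ : ℝ) (n : ℕ) (t s c : ℝ) : ℝ :=
  ∑ m ∈ Finset.range (n + 1), PnV0 d β γ m t s c

/-- Cesàro `(C,δ)` kernel on `𝕍₀^{d+1}`. -/
def KnV0Ces (d : ℕ) (β γ δ : ℝ) (n : ℕ) (t s c : ℝ) : ℝ :=
  (binomC δ n)⁻¹ * ∑ m ∈ Finset.range (n + 1), binomC (δ - 1) (n - m) * KnV0 d β γ m t s c

/-- Cesàro `(C,δ)` means `S_n^δ(ϖ_{β,γ}; f, (√t ξ, t))` on `𝕍₀^{d+1}`. -/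
def SnV0Ces (d : ℕ) (β γ δ : ℝ) (n : ℕ) (f : Euc d × ℝ → ℝ) (ξ : Euc d) (t : ℝ) : ℝ :=
  bV0 d β γ * ∫ s in (0:ℝ)..1, s ^ (((d : ℝ) - 1) / 2) * wt β γ s *
    ∫ η, f (Real.sqrt s • (η : Euc d), s) * KnV0Ces d β γ δ n t s ⟪ξ, (η : Euc d)⟫ ∂(sphMeas d)

/-- Normalization constant `τ_β` in the definition of `T_{β,γ}`. -/
def τβ (d : ℕ) (β : ℝ) : ℝ :=
  (∫ z₁ in (-1:ℝ)..1, ∫ z₂ in (-1:ℝ)..1,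
    (1 - z₁) ^ (((d : ℝ) - 2) / 2) * (1 + z₁) ^ (β - 1/2) * (1 - z₂ ^ 2) ^ β)⁻¹

/-- The operator `T_{β,γ}` on the surface of the paraboloid, with
`(x,t) = (√t ξ, t)` and `(y,s) = (√s η, s)`. -/
def TV0 (d : ℕ) (β γ : ℝ) (g : ℝ × ℝ → ℝ × ℝ → ℝ) (ξ η : Euc d) (t s : ℝ) : ℝ :=
  if β = -(1/2) then g (Real.sqrt t, t) (⟪ξ, Real.sqrt s • η⟫, s)
  else τβ d β * ∫ z₁ in (-1:ℝ)..1, ∫ z₂ in (-1:ℝ)..1,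
    g (Real.sqrt t, t) (Real.sqrt s * ((1 - z₁) / 2 * ⟪ξ, η⟫ + (1 + z₁) / 2 * z₂), s) *
      ((1 - z₁) ^ (((d : ℝ) - 2) / 2) * (1 + z₁) ^ (β - 1/2) * (1 - z₂ ^ 2) ^ β)

/-- The pseudo convolution `f ∗_{𝕍₀} g` on the surface of the paraboloid. -/
def convV0 (d : ℕ) (β γ : ℝ) (f : Euc d × ℝ → ℝ) (g : ℝ × ℝ → ℝ × ℝ → ℝ)
    (η : Euc d) (s : ℝ) : ℝ :=
  bV0 d β γ * ∫ t in (0:ℝ)..1, t ^ (((d : ℝ) - 1) / 2) * wt β γ t *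
    ∫ ξ, f (Real.sqrt t • (ξ : Euc d), t) * TV0 d β γ g (ξ : Euc d) η t s ∂(sphMeas d)

/-- The solid paraboloid `𝕍^{d+1} = {(x,t) : ‖x‖² ≤ t ≤ 1}`. -/
def Vset (d : ℕ) : Set (Euc d × ℝ) := {q | ‖q.1‖ ^ 2 ≤ q.2 ∧ q.2 ≤ 1}

/-- The weight `W_{β,γ,μ}` on the solid paraboloid. -/
def WW (d : ℕ) (β γ μ : ℝ) (q : Euc d × ℝ) : ℝ :=
  q.2 ^ β * (1 - q.2) ^ γ * (q.2 - ‖q.1‖ ^ 2) ^ (μ - 1/2)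

/-- Normalization constant `b_{β,γ,μ}`. -/
def bW (d : ℕ) (β γ μ : ℝ) : ℝ := (∫ q in Vset d, WW d β γ μ q)⁻¹

/-- The weighted measure `W_{β,γ,μ}(x,t) dx dt` on `𝕍^{d+1}`. -/
def μW (d : ℕ) (β γ μ : ℝ) : Measure (Euc d × ℝ) :=
  (volume.restrict (Vset d)).withDensity fun q => ENNReal.ofReal (WW d β γ μ q)

/-- The weight `ϖ_μ(y) = (1-‖y‖²)^{μ-1/2}` on the unit ball. -/
def wB (d : ℕ) (μ : ℝ) (y : Euc d) : ℝ := (1 - ‖y‖ ^ 2) ^ (μ - 1/2)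

/-- Normalization constant `b_μ` of `ϖ_μ` on the unit ball. -/
def bB (d : ℕ) (μ : ℝ) : ℝ := (∫ y in Metric.closedBall (0 : Euc d) 1, wB d μ y)⁻¹

/-- Normalization constant `σ_μ = (∫_{-1}^1 (1-u²)^{μ-1} du)⁻¹`. -/
def σμ (μ : ℝ) : ℝ := (∫ u in (-1:ℝ)..1, (1 - u ^ 2) ^ (μ - 1))⁻¹

/-- `ξ₀(x,t,y,s;u) = (⟨x,y⟩ + u √(t-‖x‖²) √(s-‖y‖²))/√(st)`. -/
def xi0 (d : ℕ) (x : Euc d) (t : ℝ) (y : Euc d) (s : ℝ) (u : ℝ) : ℝ :=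
  (⟪x, y⟫ + u * Real.sqrt (t - ‖x‖ ^ 2) * Real.sqrt (s - ‖y‖ ^ 2)) / Real.sqrt (s * t)

/-- Squared norms `h_{m,n}^{β,γ,μ}` on the solid paraboloid. -/
def hW (d : ℕ) (β γ μ : ℝ) (m n : ℕ) : ℝ :=
  (cJ (β + μ + ((d : ℝ) - 1) / 2) γ / cJ ((m : ℝ) + β + μ + ((d : ℝ) - 1) / 2) γ) *
    hJ (n - m) ((m : ℝ) + β + μ + ((d : ℝ) - 1) / 2) γ

/-- The reproducing kernel `P_n(W_{β,γ,μ}; (x,t), (y,s))` on the solid paraboloid. -/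
def PnW (d : ℕ) (β γ μ : ℝ) (n : ℕ) (x : Euc d) (t : ℝ) (y : Euc d) (s : ℝ) : ℝ :=
  σμ μ * ∫ u in (-1:ℝ)..1,
    (∑ m ∈ Finset.range (n + 1),
      jacobiP (n - m) ((m : ℝ) + β + μ + ((d : ℝ) - 1) / 2) γ (1 - 2 * t) *
        jacobiP (n - m) ((m : ℝ) + β + μ + ((d : ℝ) - 1) / 2) γ (1 - 2 * s) / hW d β γ μ m n *
        (Real.sqrt t) ^ m * (Real.sqrt s) ^ m *
        Zm (μ + ((d : ℝ) - 1) / 2) m (xi0 d x t y s u)) * (1 - u ^ 2) ^ (μ - 1)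

/-- Partial-sum kernel `K_n(W_{β,γ,μ})`. -/
def KnW (d : ℕ) (β γ μ : ℝ) (n : ℕ) (x : Euc d) (t : ℝ) (y : Euc d) (s : ℝ) : ℝ :=
  ∑ m ∈ Finset.range (n + 1), PnW d β γ μ m x t y s

/-- Cesàro `(C,δ)` kernel on the solid paraboloid. -/
def KnWCes (d : ℕ) (β γ μ δ : ℝ) (n : ℕ) (x : Euc d) (t : ℝ) (y : Euc d) (s : ℝ) : ℝ :=
  (binomC δ n)⁻¹ * ∑ m ∈ Finset.range (n + 1), binomC (δ - 1) (n - m) * KnW d β γ μ m x t y s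

/-- Cesàro `(C,δ)` means `S_n^δ(W_{β,γ,μ}; f, (x,t))`. -/
def SnWCes (d : ℕ) (β γ μ δ : ℝ) (n : ℕ) (f : Euc d × ℝ → ℝ) (x : Euc d) (t : ℝ) : ℝ :=
  bW d β γ μ * ∫ q in Vset d, f q * KnWCes d β γ μ δ n x t q.1 q.2 * WW d β γ μ q

/-- `ξ(x,t,y,s;z,u)` in the connection kernel on the solid paraboloid. -/
def ξW (d : ℕ) (x : Euc d) (t : ℝ) (y : Euc d) (s : ℝ) (z₁ z₂ u : ℝ) : ℝ :=
  (1 - z₁) / 2 * xi0 d x t y s u + (1 + z₁) / 2 * z₂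

/-- Normalization constant `κ_β`. -/
def κβ (d : ℕ) (β μ : ℝ) : ℝ :=
  (∫ z₁ in (-1:ℝ)..1, ∫ z₂ in (-1:ℝ)..1, ∫ u in (-1:ℝ)..1,
    (1 - z₁) ^ (μ + ((d : ℝ) - 1) / 2) * (1 + z₁) ^ (β - 1) * (1 - z₂ ^ 2) ^ (β - 1/2) *
      (1 - u ^ 2) ^ (μ - 1))⁻¹

/-- The operator `T_{β,γ,μ}` on the solid paraboloid. -/
def TW (d : ℕ) (β γ μ : ℝ) (g : ℝ × ℝ → ℝ × ℝ → ℝ) (x : Euc d) (t : ℝ) (y : Euc d) (s : ℝ) : ℝ :=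
  if β = 0 then
    σμ μ * ∫ u in (-1:ℝ)..1,
      g (Real.sqrt t, t) (Real.sqrt s * xi0 d x t y s u, s) * (1 - u ^ 2) ^ (μ - 1)
  else
    κβ d β μ * ∫ z₁ in (-1:ℝ)..1, ∫ z₂ in (-1:ℝ)..1, ∫ u in (-1:ℝ)..1,
      g (Real.sqrt t, t) (Real.sqrt s * ξW d x t y s z₁ z₂ u, s) *
        ((1 - z₁) ^ (μ + ((d : ℝ) - 1) / 2) * (1 + z₁) ^ (β - 1) * (1 - z₂ ^ 2) ^ (β - 1/2) *
          (1 - u ^ 2) ^ (μ - 1))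

/-- Directional derivative `⟨x,∇⟩f(x) = ∑ xᵢ ∂ᵢ f(x)`. -/
def xGrad (d : ℕ) (f : Euc d → ℝ) (x : Euc d) : ℝ := fderiv ℝ f x x

/-- Laplacian `Δf(x) = ∑ ∂ᵢ² f(x)`. -/
def lapl (d : ℕ) (f : Euc d → ℝ) (x : Euc d) : ℝ :=
  ∑ i : Fin d, fderiv ℝ (fun y => fderiv ℝ f y (EuclideanSpace.single i 1)) x
    (EuclideanSpace.single i 1)


/-- `Q_{m,n}(x,t) = P_{n-m}^{(m+α,γ)}(1-2t) t^{m/2} Y(x/√t)`. -/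
def QV0gen (d : ℕ) (α γ : ℝ) (m n : ℕ) (Y : Euc d → ℝ) (x : Euc d) (t : ℝ) : ℝ :=
  jacobiP (n - m) ((m : ℝ) + α) γ (1 - 2 * t) * (Real.sqrt t) ^ m * Y ((Real.sqrt t)⁻¹ • x)

end

noncomputable section Helpers

def RH : ℕ → ℝ → ℝ
  | 0, _ => 1
  | (k+1), a => a * poch (a + k + 2) k / ((k+1).factorial : ℝ)

lemma poch_zero (a : ℝ) : poch a 0 = 1 := by simp [poch]

lemma poch_succ (a : ℝ) (n : ℕ) : poch a (n+1) = poch a n * (a + n) := by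
  simp [poch, Finset.prod_range_succ]

lemma poch_succ' (a : ℝ) (n : ℕ) : poch a (n+1) = a * poch (a+1) n := by
  unfold poch
  rw [Finset.prod_range_succ', mul_comm]
  simp only [Nat.cast_zero, add_zero]
  congr 1
  apply Finset.prod_congr rfl
  intro i _
  push_cast; ring

lemma poch_add (a : ℝ) (m n : ℕ) : poch a (m+n) = poch a m * poch (a+m) n := by
  induction n with
  | zero => simp [poch_zero]
  | succ n ih => rw [← add_assoc, poch_succ, ih, poch_succ]; push_cast; ring

lemma poch_pos {a : ℝ} (ha : 0 < a) (n : ℕ) : 0 < poch a n :=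
  Finset.prod_pos fun i _ => by positivity

lemma poch_dup (a : ℝ) (n : ℕ) : poch (2*a) (2*n) = 4^n * poch a n * poch (a+1/2) n := by
  induction n with
  | zero => simp [poch_zero]
  | succ n ih =>
    rw [show 2*(n+1) = 2*n+1+1 by ring, poch_succ, poch_succ, ih, poch_succ, poch_succ]
    push_cast; ring

lemma poch_neg_nat (m k : ℕ) : ∀ r, m = k + r → poch (-(m:ℝ)) k * (r.factorial : ℝ) = (-1)^k * (m.factorial:ℝ) := by
  induction k with
  | zero => intro r h; simp at h; subst h; simp [poch_zero]
  | succ k ih =>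
    intro r h
    have := ih (r+1) (by omega)
    rw [Nat.factorial_succ] at this
    rw [poch_succ, pow_succ]
    have h' : (m:ℝ) = k + 1 + r := by rw [h]; push_cast; ring
    push_cast at this
    have e : (-(m:ℝ) + k) = -(r+1) := by rw [h']; ring
    rw [e]
    linear_combination -this

lemma RH_zero_right (k : ℕ) : RH (k+1) 0 = 0 := by simp [RH]

lemma RH_rec (k : ℕ) (a : ℝ) : RH (k+1) (a+1) = RH (k+1) a + RH k (a+2) := by
  cases k with
  | zero => simp [RH, poch_zero]; try ring
  | succ k =>
    simp only [RH]
    have h1 : poch (a + 1 + ((k+1:ℕ):ℝ) + 2) (k+1) = poch (a+2+k+2) k * (a + 2*k+4) := by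
      rw [poch_succ]; push_cast
      rw [show a + 1 + ((k:ℝ)+1) + 2 = a+2+k+2 by ring]; ring
    have h2 : poch (a + ((k+1:ℕ):ℝ) + 2) (k+1) = (a+k+3) * poch (a+2+k+2) k := by
      rw [poch_succ']; push_cast
      rw [show a + ((k:ℝ)+1) + 2 +1 = a+2+k+2 by ring]; ring
    rw [h1, h2, Nat.factorial_succ (k+1)]
    have : ((k+1).factorial : ℝ) ≠ 0 := by positivity
    have : ((k:ℝ)+1+1) ≠ 0 := by positivity
    push_cast
    field_simp
    ring

lemma RH_poly (k : ℕ) : ∃ p : Polynomial ℝ, ∀ a, p.eval a = RH k a := by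
  cases k with
  | zero => exact ⟨1, by simp [RH]⟩
  | succ k =>
    refine ⟨Polynomial.C ((k+1).factorial : ℝ)⁻¹ * (Polynomial.X * ∏ i ∈ Finset.range k, (Polynomial.X + Polynomial.C ((k:ℝ)+2+i))), fun a => ?_⟩
    simp only [RH, poch, Polynomial.eval_mul, Polynomial.eval_C, Polynomial.eval_X, Polynomial.eval_prod, Polynomial.eval_add]
    rw [div_eq_inv_mul]
    congr 2
    apply Finset.prod_congr rfl
    intro i _; ring

lemma RH_conv (p : ℕ) : ∀ a b : ℝ, ∑ l ∈ Finset.range (p+1), RH (p-l) a * RH l b = RH p (a+b) := by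
  induction p with
  | zero => intro a b; simp [RH]
  | succ p ih =>
    intro a b
    have hS : ∀ a : ℝ, ∑ l ∈ Finset.range (p+1+1), RH (p+1-l) (a+1) * RH l b
        = ∑ l ∈ Finset.range (p+1+1), RH (p+1-l) a * RH l b + RH p (a+2+b) := by
      intro a
      rw [Finset.sum_range_succ, Finset.sum_range_succ _ (p+1), ← ih (a+2) b, Nat.sub_self]
      have : ∀ l ∈ Finset.range (p+1), RH (p+1-l) (a+1) * RH l b
          = RH (p+1-l) a * RH l b + RH (p-l) (a+2) * RH l b := by
        intro l hl
        have : l ≤ p := by simpa [Nat.lt_succ_iff] using hl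
        rw [show p + 1 - l = (p-l)+1 by omega, RH_rec]; ring
      rw [Finset.sum_congr rfl this, Finset.sum_add_distrib]
      simp only [RH]; ring
    have hN : ∀ n : ℕ, ∑ l ∈ Finset.range (p+1+1), RH (p+1-l) n * RH l b = RH (p+1) (n+b) := by
      intro n
      induction n with
      | zero =>
        rw [Finset.sum_range_succ, Finset.sum_eq_zero]
        · simp [RH]
        · intro l hl
          have : l ≤ p := by simpa [Nat.lt_succ_iff] using hl
          rw [show p + 1 - l = (p-l)+1 by omega]
          simp [RH]
      | succ n ihn =>
        push_cast
        rw [hS, ihn, show (n:ℝ)+1+b = (n+b)+1 by ring, RH_rec]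
        congr 2; ring
    choose P hP using RH_poly
    have key : (∑ l ∈ Finset.range (p+1+1), P (p+1-l) * Polynomial.C (RH l b))
        = (P (p+1)).comp (Polynomial.X + Polynomial.C b) := by
      apply Polynomial.eq_of_infinite_eval_eq
      apply (Set.infinite_range_of_injective (Nat.cast_injective (R := ℝ))).mono
      rintro _ ⟨n, rfl⟩
      simp only [Set.mem_ofPred_eq, Polynomial.eval_finsetSum, Polynomial.eval_mul, hP, Polynomial.eval_C, Polynomial.eval_comp, Polynomial.eval_add, Polynomial.eval_X]
      exact hN n
    have := congrArg (Polynomial.eval a) key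
    simpa only [Polynomial.eval_finsetSum, Polynomial.eval_mul, hP, Polynomial.eval_C, Polynomial.eval_comp, Polynomial.eval_add, Polynomial.eval_X] using this

lemma RH_two_mul {b : ℝ} (hb : 0 < b) (l : ℕ) :
    RH l (2*b) = 4^l * poch b l * poch (b+1/2) l / ((l.factorial:ℝ) * poch (2*b+1) l) := by
  rw [← poch_dup]
  have h0 : poch (2*b+1) l ≠ 0 := (poch_pos (by positivity) l).ne'
  have h1 : (l.factorial:ℝ) ≠ 0 := by positivity
  cases l with
  | zero => simp [RH, poch_zero]
  | succ k =>
    simp only [RH]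
    have : poch (2*b) (2*(k+1)) = 2*b * (poch (2*b+1) (k+1) * poch (2*b+k+2) k) := by
      rw [show 2*(k+1) = (k+1+k)+1 by ring, poch_succ', poch_add]
      congr 3; push_cast; ring
    rw [this]
    field_simp

/-- coefficients of `Z_m^λ` in powers of `(1-x)/2` -/
def zc (lam : ℝ) (m k : ℕ) : ℝ :=
  (-1)^m * 4^k * poch (lam+1) k / (k.factorial : ℝ) * RH (m-k) (-2*(lam+m))

lemma zc_eq {lam : ℝ} (h : 0 < lam) (m k : ℕ) (hk : k ≤ m) :
    zc lam m k = ((m : ℝ) + lam) / lam * (poch (2 * lam) m / poch (lam + 1/2) m) *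
      ((poch (lam - 1/2 + 1) m / (m.factorial : ℝ)) *
      ((poch (-(m : ℝ)) k * poch ((m : ℝ) + (lam-1/2) + (lam-1/2) + 1) k) /
        (poch (lam - 1/2 + 1) k * (k.factorial : ℝ)))) := by
  obtain ⟨r, rfl⟩ := Nat.exists_eq_add_of_le hk
  have e1 : lam - 1/2 + 1 = lam + 1/2 := by ring
  have e2 : ((k+r:ℕ):ℝ) + (lam-1/2) + (lam-1/2) + 1 = 2*lam + ((k+r:ℕ):ℝ) := by ring
  rw [e1, e2]
  have hn := poch_neg_nat (k+r) k r rfl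
  have p1 : 0 < poch (lam+1/2) (k+r) := poch_pos (by positivity) _
  have p2 : 0 < poch (lam+1/2) k := poch_pos (by positivity) _
  have p3 : 0 < poch (lam+1) k := poch_pos (by positivity) _
  have hd := poch_dup (lam+1/2) k
  rw [show lam + 1/2 + 1/2 = lam + 1 by ring, show 2*(lam+1/2) = 2*lam+1 by ring] at hd
  have hadd := poch_add (2*lam) (k+r) k
  have f1 : (r.factorial:ℝ) ≠ 0 := by positivity
  have f2 : (k.factorial:ℝ) ≠ 0 := by positivity
  have f3 : ((k+r).factorial:ℝ) ≠ 0 := by positivity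
  have hneg : poch (-((k+r:ℕ):ℝ)) k = (-1)^k * ((k+r).factorial:ℝ) / (r.factorial:ℝ) := by
    rw [← hn]; field_simp
  -- core
  have core : (-1)^r * RH r (-2*(lam+((k+r:ℕ):ℝ))) * ((r.factorial:ℝ) * lam * poch (2*lam+1) (2*k))
      = (((k+r:ℕ):ℝ)+lam) * poch (2*lam) (k+r+k) := by
    cases r with
    | zero =>
      have a1 := poch_succ (2*lam) (2*k)
      have a2 := poch_succ' (2*lam) (2*k)
      rw [a2] at a1
      simp only [RH, add_zero]
      rw [← two_mul]
      push_cast at a1 ⊢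
      simp
      linear_combination a1/2
    | succ r =>
      simp only [RH]
      have rev : poch (-2*(lam+((k+(r+1):ℕ):ℝ)) + r + 2) r = (-1)^r * poch (2*lam+1+((2*k:ℕ):ℝ)) r := by
        unfold poch
        rw [← Finset.prod_range_reflect]
        rw [show ((-1:ℝ))^r = ∏ i ∈ Finset.range r, (-1:ℝ) by simp, ← Finset.prod_mul_distrib]
        apply Finset.prod_congr rfl
        intro i hi
        have hi := Finset.mem_range.1 hi
        rw [show r - 1 - i = r - (1+i) by omega, Nat.cast_sub (by omega)]
        push_cast; ring
      rw [rev, show k+(r+1)+k = (2*k+r)+1 by ring, poch_succ', poch_add (2*lam+1) (2*k) r]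
      have : ((-1:ℝ)^r)*((-1:ℝ)^r) = 1 := by rw [← mul_pow]; simp
      push_cast
      field_simp
      rw [pow_succ]
      linear_combination ((lam+(k+(r+1))) * poch (2*lam+1+2*k) r * poch (2*lam+1) (2*k)) * this
  rw [hd, hadd] at core
  unfold zc
  rw [hneg, show k + r - k = r by omega, pow_add]
  have h4 : (-1:ℝ)^k * (-1:ℝ)^k = 1 := by rw [← mul_pow]; simp
  generalize poch (lam+1/2) (k+r) = P1 at *
  generalize poch (lam+1/2) k = P2 at *
  generalize poch (lam+1) k = P3 at *
  generalize poch (2*lam) (k+r) = P4 at *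
  generalize poch (2*lam+((k+r:ℕ):ℝ)) k = P5 at *
  generalize RH r (-2*(lam+((k+r:ℕ):ℝ))) = P6 at *
  field_simp
  linear_combination core

lemma Zm_eq {lam : ℝ} (h : 0 < lam) (m : ℕ) (x : ℝ) :
    Zm lam m x = ∑ k ∈ Finset.range (m+1), zc lam m k * ((1-x)/2)^k := by
  unfold Zm jacobiP
  rw [if_neg h.ne', Finset.mul_sum, Finset.mul_sum]
  apply Finset.sum_congr rfl
  intro k hk
  rw [zc_eq h m k (by simpa [Nat.lt_succ_iff] using hk)]
  ring

lemma zc_conv {lam b : ℝ} (hl : 0 < lam) (hb : 0 < b) (m k : ℕ) (hk : k ≤ m) :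
    ∑ l ∈ Finset.range (m+1-k), zc (lam+b) m (k+l) * ((k+l).choose k : ℝ) *
      (poch (lam+1) k * poch b l / poch (lam+1+b) (k+l) * (poch (b+1/2) l / poch (2*b+1) l))
      = zc lam m k := by
  obtain ⟨r, rfl⟩ := Nat.exists_eq_add_of_le hk
  have hR := RH_conv r (-2*(lam+b+((k+r:ℕ):ℝ))) (2*b)
  rw [show -2*(lam+b+((k+r:ℕ):ℝ)) + 2*b = -2*(lam+((k+r:ℕ):ℝ)) by ring] at hR
  unfold zc
  rw [show k+r+1-k = r+1 by omega, show k+r-k = r by omega, ← hR, Finset.mul_sum]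
  apply Finset.sum_congr rfl
  intro l hl
  rw [RH_two_mul hb, show k + r - (k+l) = r - l by omega, show lam+1+b = lam+b+1 by ring]
  have p1 : 0 < poch (lam+b+1) (k+l) := poch_pos (by positivity) _
  have p2 : 0 < poch (2*b+1) l := poch_pos (by positivity) _
  have hc : ((k+l).choose k : ℝ) = ((k+l).factorial:ℝ) / ((k.factorial:ℝ) * (l.factorial:ℝ)) := by
    rw [eq_div_iff (by positivity)]
    have := Nat.add_choose_mul_factorial_mul_factorial k l
    rw [← Nat.choose_symm_add] at this
    rw [← mul_assoc]
    exact_mod_cast this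
  rw [hc, pow_add]
  have f1 : (l.factorial:ℝ) ≠ 0 := by positivity
  have f2 : (k.factorial:ℝ) ≠ 0 := by positivity
  have f3 : ((k+l).factorial:ℝ) ≠ 0 := by positivity
  generalize poch (lam+b+1) (k+l) = P1 at *
  generalize poch (2*b+1) l = P2 at *
  field_simp
  rw [pow_add]; ring

lemma jac_Z {a : ℝ} (h : 0 < a) (m : ℕ) (x : ℝ) :
    jacobiP m (a-1/2) (a-1/2) 1 * jacobiP m (a-1/2) (a-1/2) x / hJ m (a-1/2) (a-1/2) = Zm a m x := by
  have h1 : jacobiP m (a-1/2) (a-1/2) 1 = poch (a+1/2) m / (m.factorial:ℝ) := by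
    unfold jacobiP
    rw [Finset.sum_range_succ', Finset.sum_eq_zero]
    · simp [poch_zero]; congr 2; ring
    · intro i _; simp
  rw [h1]
  unfold Zm hJ
  rw [if_neg h.ne', show a - 1/2+1 = a+1/2 by ring, show a-1/2+(a-1/2)+2 = 2*a+1 by ring,
    show a-1/2+(a-1/2)+(m:ℝ)+1 = 2*a+m by ring, show a-1/2+(a-1/2)+2*(m:ℝ)+1 = 2*a+2*m by ring]
  have p1 : 0 < poch (a+1/2) m := poch_pos (by positivity) _
  have p2 : 0 < poch (2*a+1) m := poch_pos (by positivity) _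
  have f1 : (m.factorial:ℝ) ≠ 0 := by positivity
  have p3 : 0 < 2*a+m := by positivity
  have p4 : 0 < 2*a+2*m := by positivity
  have e := (poch_succ (2*a) m).symm.trans (poch_succ' (2*a) m)
  generalize poch (a+1/2) m = P1 at *
  generalize poch (2*a+1) m = P2 at *
  generalize poch (2*a) m = P3 at *
  generalize jacobiP m (a-1/2) (a-1/2) x = P4 at *
  field_simp
  linear_combination -(P4*(a+m))*e
lemma bmom {a b : ℝ} (ha : 0 < a) (hb : 0 < b) :
    IntervalIntegrable (fun x : ℝ => x^(a-1)*(1-x)^(b-1)) volume 0 1 ∧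
    ∫ x in (0:ℝ)..1, x^(a-1)*(1-x)^(b-1) = ProbabilityTheory.beta a b := by
  have hc := Complex.betaIntegral_convergent (u := (a:ℂ)) (v := (b:ℂ)) (by simpa) (by simpa)
  have hEq : ∀ x ∈ Set.uIcc (0:ℝ) 1, (x : ℂ) ^ ((a:ℂ) - 1) * (1 - (x : ℂ)) ^ ((b:ℂ) - 1)
      = ((x^(a-1)*(1-x)^(b-1) : ℝ) : ℂ) := by
    intro x hx
    rw [Set.uIcc_of_le zero_le_one] at hx
    rw [Complex.ofReal_mul, Complex.ofReal_cpow hx.1, Complex.ofReal_cpow (by linarith [hx.2])]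
    push_cast; rfl
  have hc2 : IntervalIntegrable (fun x : ℝ => ((x^(a-1)*(1-x)^(b-1) : ℝ) : ℂ)) volume 0 1 :=
    hc.congr (fun x hx => hEq x (Set.uIoc_subset_uIcc hx))
  refine ⟨?_, ?_⟩
  · rw [intervalIntegrable_iff] at hc2 ⊢
    exact hc2.re
  · rw [ProbabilityTheory.beta_eq_betaIntegralReal a b ha hb, Complex.betaIntegral,
      intervalIntegral.integral_congr hEq, intervalIntegral.integral_ofReal, Complex.ofReal_re]

lemma pow_mul_rpow' {x a : ℝ} (hx : 0 ≤ x) (ha : 0 < a) (k : ℕ) :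
    x^k * x^(a-1) = x^(a+k-1) := by
  rcases hx.eq_or_lt with rfl | h
  · cases k with
    | zero => simp
    | succ k =>
      have : a + ((k+1:ℕ):ℝ) - 1 = a + k := by push_cast; ring
      rw [this, Real.zero_rpow (show a + (k:ℝ) ≠ 0 by positivity)]
      simp
  · rw [← Real.rpow_natCast, ← Real.rpow_add h]; congr 1; ring

lemma mom {a b : ℝ} (ha : 0 < a) (hb : 0 < b) (k l : ℕ) :
    IntervalIntegrable (fun z : ℝ => ((1-z)/2)^k*((1+z)/2)^l*((1-z)^(a-1)*(1+z)^(b-1))) volume (-1) 1 ∧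
    ∫ z in (-1:ℝ)..1, ((1-z)/2)^k*((1+z)/2)^l*((1-z)^(a-1)*(1+z)^(b-1)) =
      2 * (2^(a-1)*2^(b-1)) * ProbabilityTheory.beta (a+k) (b+l) := by
  obtain ⟨h1, h2⟩ := bmom (a := a+k) (b := b+l) (by positivity) (by positivity)
  set f : ℝ → ℝ := fun x => x^(a+k-1)*(1-x)^(b+l-1) with hf
  have hEq : ∀ z ∈ Set.uIcc (-1:ℝ) 1, ((1-z)/2)^k*((1+z)/2)^l*((1-z)^(a-1)*(1+z)^(b-1))
      = (2^(a-1)*2^(b-1)) * f (1/2 - z/2) := by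
    intro z hz
    rw [Set.uIcc_of_le (by norm_num)] at hz
    have z1 : 0 ≤ (1-z)/2 := by linarith [hz.2]
    have z2 : 0 ≤ (1+z)/2 := by linarith [hz.1]
    rw [hf]
    simp only
    rw [show 1/2 - z/2 = (1-z)/2 by ring, show 1 - (1-z)/2 = (1+z)/2 by ring,
      ← pow_mul_rpow' z1 ha, ← pow_mul_rpow' z2 hb]
    have e1 : (1-z)^(a-1) = 2^(a-1) * ((1-z)/2)^(a-1) := by
      rw [← Real.mul_rpow (by norm_num) z1]; congr 1; ring
    have e2 : (1+z)^(b-1) = 2^(b-1) * ((1+z)/2)^(b-1) := by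
      rw [← Real.mul_rpow (by norm_num) z2]; congr 1; ring
    rw [e1, e2]; ring
  constructor
  · have h3 : IntervalIntegrable (fun z => f (1/2 - z/2)) volume (-1) 1 := by
      have := (h1.comp_sub_left (1/2)).comp_mul_left (c := 1/2)
      norm_num at this
      refine this.symm.congr ?_
      intro z _
      simp only [hf]
      congr 2 <;> ring
    exact (h3.const_mul _).congr (fun z hz => (hEq z (Set.uIoc_subset_uIcc hz)).symm)
  · rw [intervalIntegral.integral_congr hEq, intervalIntegral.integral_const_mul,
      intervalIntegral.integral_comp_sub_div f (by norm_num) (1/2), ← h2]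
    norm_num
    ring

lemma Gamma_add_nat {a : ℝ} (ha : 0 < a) (k : ℕ) : Real.Gamma (a+k) = poch a k * Real.Gamma a := by
  induction k with
  | zero => simp [poch_zero]
  | succ k ih =>
    push_cast
    rw [← add_assoc, Real.Gamma_add_one (by positivity), ih, poch_succ]; ring

lemma mom2 {a b : ℝ} (ha : 0 < a) (hb : 0 < b) :
    0 < ∫ z in (-1:ℝ)..1, ((1-z)^(a-1)*(1+z)^(b-1)) ∧
    ∀ k l : ℕ, ∫ z in (-1:ℝ)..1, ((1-z)/2)^k*((1+z)/2)^l*((1-z)^(a-1)*(1+z)^(b-1)) =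
      (∫ z in (-1:ℝ)..1, ((1-z)^(a-1)*(1+z)^(b-1))) * (poch a k * poch b l / poch (a+b) (k+l)) := by
  have h0 := (mom ha hb 0 0).2
  simp only [pow_zero, one_mul, Nat.cast_zero, add_zero] at h0
  rw [h0]
  refine ⟨by have := ProbabilityTheory.beta_pos ha hb; positivity, fun k l => ?_⟩
  rw [(mom ha hb k l).2]
  unfold ProbabilityTheory.beta
  rw [show a + k + (b+l) = a+b+((k+l:ℕ):ℝ) by push_cast; ring, Gamma_add_nat ha, Gamma_add_nat hb,
    Gamma_add_nat (by positivity)]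
  have : 0 < poch (a+b) (k+l) := poch_pos (by positivity) _
  have : 0 < Real.Gamma (a+b) := Real.Gamma_pos_of_pos (by positivity)
  field_simp

lemma sq_weight (b : ℝ) {z : ℝ} (hz : z ∈ Set.uIcc (-1:ℝ) 1) :
    (1-z^2)^b = (1-z)^b*(1+z)^b := by
  rw [Set.uIcc_of_le (by norm_num)] at hz
  rw [← Real.mul_rpow (by linarith [hz.2]) (by linarith [hz.1])]
  congr 1; ring

/-- well-behaved triple integrals -/
structure Nice (F : ℝ → ℝ → ℝ → ℝ) (c : ℝ) : Prop where
  h3 : ∀ z₁ z₂, IntervalIntegrable (fun u => F z₁ z₂ u) volume (-1) 1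
  h2 : ∀ z₁, IntervalIntegrable (fun z₂ => ∫ u in (-1:ℝ)..1, F z₁ z₂ u) volume (-1) 1
  h1 : IntervalIntegrable (fun z₁ => ∫ z₂ in (-1:ℝ)..1, ∫ u in (-1:ℝ)..1, F z₁ z₂ u) volume (-1) 1
  eq : ∫ z₁ in (-1:ℝ)..1, ∫ z₂ in (-1:ℝ)..1, ∫ u in (-1:ℝ)..1, F z₁ z₂ u = c

lemma Nice.prod {f g h : ℝ → ℝ} (hf : IntervalIntegrable f volume (-1) 1)
    (hg : IntervalIntegrable g volume (-1) 1) (hh : IntervalIntegrable h volume (-1) 1) (c : ℝ) :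
    Nice (fun z₁ z₂ u => c * (f z₁ * g z₂ * h u))
      (c * ((∫ z in (-1:ℝ)..1, f z) * (∫ z in (-1:ℝ)..1, g z) * (∫ z in (-1:ℝ)..1, h z))) := by
  have e3 : ∀ z₁ z₂, ∫ u in (-1:ℝ)..1, c * (f z₁ * g z₂ * h u)
      = (c * f z₁ * ∫ z in (-1:ℝ)..1, h z) * g z₂ := by
    intro z₁ z₂
    rw [intervalIntegral.integral_const_mul, intervalIntegral.integral_const_mul]; ring
  have e2 : ∀ z₁, ∫ z₂ in (-1:ℝ)..1, ∫ u in (-1:ℝ)..1, c * (f z₁ * g z₂ * h u)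
      = (c * (∫ z in (-1:ℝ)..1, g z) * ∫ z in (-1:ℝ)..1, h z) * f z₁ := by
    intro z₁
    simp only [e3]
    rw [intervalIntegral.integral_const_mul]; ring
  refine ⟨fun _ _ => (hh.const_mul _).const_mul _, fun z₁ => ?_, ?_, ?_⟩
  · simp only [e3]; exact hg.const_mul _
  · simp only [e2]; exact hf.const_mul _
  · simp only [e2]; rw [intervalIntegral.integral_const_mul]; ring

lemma ii_sum {ι : Type*} {s : Finset ι} {f : ι → ℝ → ℝ}
    (h : ∀ i ∈ s, IntervalIntegrable (f i) volume (-1) 1) :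
    IntervalIntegrable (fun x => ∑ i ∈ s, f i x) volume (-1) 1 := by
  have := IntervalIntegrable.sum s h
  rwa [show (∑ i ∈ s, f i) = fun x => ∑ i ∈ s, f i x by ext x; simp] at this

lemma Nice.sum {ι : Type*} (s : Finset ι) {F : ι → ℝ → ℝ → ℝ → ℝ} {c : ι → ℝ}
    (h : ∀ i ∈ s, Nice (F i) (c i)) :
    Nice (fun z₁ z₂ u => ∑ i ∈ s, F i z₁ z₂ u) (∑ i ∈ s, c i) := by
  have e3 : ∀ z₁ z₂, ∫ u in (-1:ℝ)..1, ∑ i ∈ s, F i z₁ z₂ u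
      = ∑ i ∈ s, ∫ u in (-1:ℝ)..1, F i z₁ z₂ u := by
    intro z₁ z₂
    exact intervalIntegral.integral_finsetSum fun i hi => (h i hi).h3 z₁ z₂
  have e2 : ∀ z₁, ∫ z₂ in (-1:ℝ)..1, ∫ u in (-1:ℝ)..1, ∑ i ∈ s, F i z₁ z₂ u
      = ∑ i ∈ s, ∫ z₂ in (-1:ℝ)..1, ∫ u in (-1:ℝ)..1, F i z₁ z₂ u := by
    intro z₁
    simp only [e3]
    exact intervalIntegral.integral_finsetSum fun i hi => (h i hi).h2 z₁
  refine ⟨fun z₁ z₂ => ?_, fun z₁ => ?_, ?_, ?_⟩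
  · exact ii_sum fun i hi => (h i hi).h3 z₁ z₂
  · simp only [e3]
    exact ii_sum fun i hi => (h i hi).h2 z₁
  · simp only [e2]
    exact ii_sum fun i hi => (h i hi).h1
  · simp only [e2]
    rw [intervalIntegral.integral_finsetSum fun i hi => (h i hi).h1]
    exact Finset.sum_congr rfl fun i hi => (h i hi).eq
lemma Nice_core {lam b mu : ℝ} (hl : 0 < lam) (hb : 0 < b) (hmu : 0 < mu) {X : ℝ → ℝ}
    (hX : Continuous X) (n : ℕ) (c : ℕ → ℝ) :
    Nice (fun z₁ z₂ u => (∑ m ∈ Finset.range (n+1), c m *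
        Zm (lam+b) m ((1-z₁)/2 * X u + (1+z₁)/2 * z₂)) *
        ((1-z₁)^lam * (1+z₁)^(b-1) * (1-z₂^2)^(b-1/2) * (1-u^2)^(mu-1)))
      ((∫ z in (-1:ℝ)..1, (1-z)^lam * (1+z)^(b-1)) * (∫ z in (-1:ℝ)..1, (1-z^2)^(b-1/2)) *
        ∫ u in (-1:ℝ)..1, (∑ m ∈ Finset.range (n+1), c m * Zm lam m (X u)) * (1-u^2)^(mu-1)) := by
  set f : ℕ → ℕ → ℝ → ℝ := fun k l z => ((1-z)/2)^k*((1+z)/2)^l*((1-z)^lam*(1+z)^(b-1)) with hf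
  set g : ℕ → ℝ → ℝ := fun l z => ((1-z)/2)^l * (1-z^2)^(b-1/2) with hg
  set h : ℕ → ℝ → ℝ := fun k u => ((1-X u)/2)^k * (1-u^2)^(mu-1) with hh
  have hl1 : 0 < lam + 1 := by positivity
  have hb2 : 0 < b + 1/2 := by positivity
  have fi : ∀ k l, IntervalIntegrable (f k l) volume (-1) 1 := by
    intro k l
    have := (mom hl1 hb k l).1
    simpa only [add_sub_cancel_right] using this
  have fv : ∀ k l, ∫ z in (-1:ℝ)..1, f k l z = (∫ z in (-1:ℝ)..1, (1-z)^lam * (1+z)^(b-1)) *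
      (poch (lam+1) k * poch b l / poch (lam+1+b) (k+l)) := by
    intro k l
    have := (mom2 hl1 hb).2 k l
    simpa only [add_sub_cancel_right] using this
  have e12 : b + 1/2 - 1 = b - 1/2 := by ring
  have gcongr' : ∀ l, ∀ z ∈ Set.uIcc (-1:ℝ) 1,
      ((1-z)/2)^l*((1+z)/2)^0*((1-z)^(b+1/2-1)*(1+z)^(b+1/2-1)) = g l z := by
    intro l z hz
    simp only [hg]
    rw [sq_weight _ hz, e12]; ring
  have gi : ∀ l, IntervalIntegrable (g l) volume (-1) 1 := fun l =>
    (mom hb2 hb2 l 0).1.congr fun z hz => gcongr' l z (Set.uIoc_subset_uIcc hz)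
  have g0 : (∫ z in (-1:ℝ)..1, (1-z^2)^(b-1/2)) = ∫ z in (-1:ℝ)..1, (1-z)^(b+1/2-1)*(1+z)^(b+1/2-1) := by
    apply intervalIntegral.integral_congr
    intro z hz
    simp only
    rw [sq_weight _ hz, e12]
  have gv : ∀ l, ∫ z in (-1:ℝ)..1, g l z = (∫ z in (-1:ℝ)..1, (1-z^2)^(b-1/2)) *
      (poch (b+1/2) l / poch (2*b+1) l) := by
    intro l
    rw [g0]
    have := (mom2 hb2 hb2).2 l 0
    rw [intervalIntegral.integral_congr (gcongr' l)] at this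
    rw [this, poch_zero, mul_one, add_zero, show b+1/2+(b+1/2) = 2*b+1 by ring]
  have hi : ∀ k, IntervalIntegrable (h k) volume (-1) 1 := by
    intro k
    have h1 := (mom hmu hmu 0 0).1
    have h2 : IntervalIntegrable (fun u : ℝ => (1-u^2)^(mu-1)) volume (-1) 1 := by
      refine h1.congr fun u hu => ?_
      rw [sq_weight _ (Set.uIoc_subset_uIcc hu)]; ring
    exact h2.continuousOn_mul (by fun_prop)
  -- value
  have hval : ((∫ z in (-1:ℝ)..1, (1-z)^lam * (1+z)^(b-1)) * (∫ z in (-1:ℝ)..1, (1-z^2)^(b-1/2)) *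
        ∫ u in (-1:ℝ)..1, (∑ m ∈ Finset.range (n+1), c m * Zm lam m (X u)) * (1-u^2)^(mu-1))
      = ∑ m ∈ Finset.range (n+1), ∑ k ∈ Finset.range (m+1), ∑ l ∈ Finset.range (m+1-k),
        (c m * (zc (lam+b) m (k+l) * ((k+l).choose k : ℝ))) *
          ((∫ z in (-1:ℝ)..1, f k l z) * (∫ z in (-1:ℝ)..1, g l z) * (∫ z in (-1:ℝ)..1, h k z)) := by
    have e : ∀ u : ℝ, (∑ m ∈ Finset.range (n+1), c m * Zm lam m (X u)) * (1-u^2)^(mu-1)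
        = ∑ m ∈ Finset.range (n+1), ∑ k ∈ Finset.range (m+1), (c m * zc lam m k) * h k u := by
      intro u
      rw [Finset.sum_mul]
      refine Finset.sum_congr rfl fun m _ => ?_
      rw [Zm_eq hl, Finset.mul_sum, Finset.sum_mul]
      refine Finset.sum_congr rfl fun k _ => ?_
      simp only [hh]; ring
    simp only [e]
    rw [intervalIntegral.integral_finsetSum
      (fun m _ => ii_sum fun k _ => (hi k).const_mul _), Finset.mul_sum]
    refine Finset.sum_congr rfl fun m _ => ?_
    rw [intervalIntegral.integral_finsetSum (fun k _ => (hi k).const_mul _), Finset.mul_sum]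
    refine Finset.sum_congr rfl fun k hk => ?_
    rw [intervalIntegral.integral_const_mul,
      ← zc_conv hl hb m k (by simpa [Nat.lt_succ_iff] using hk), Finset.mul_sum, Finset.sum_mul, Finset.mul_sum]
    refine Finset.sum_congr rfl fun l _ => ?_
    rw [fv, gv]; ring
  have hfun : (fun z₁ z₂ u => (∑ m ∈ Finset.range (n+1), c m *
        Zm (lam+b) m ((1-z₁)/2 * X u + (1+z₁)/2 * z₂)) *
        ((1-z₁)^lam * (1+z₁)^(b-1) * (1-z₂^2)^(b-1/2) * (1-u^2)^(mu-1)))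
      = fun z₁ z₂ u => ∑ m ∈ Finset.range (n+1), ∑ k ∈ Finset.range (m+1), ∑ l ∈ Finset.range (m+1-k),
        (c m * (zc (lam+b) m (k+l) * ((k+l).choose k : ℝ))) * (f k l z₁ * g l z₂ * h k u) := by
    funext z₁ z₂ u
    rw [Finset.sum_mul]
    refine Finset.sum_congr rfl fun m _ => ?_
    rw [Zm_eq (by positivity)]
    rw [← Finset.sum_range_diag_flip (m+1) (fun k l => (c m * (zc (lam+b) m (k+l) * ((k+l).choose k : ℝ))) * (f k l z₁ * g l z₂ * h k u)),
      Finset.mul_sum, Finset.sum_mul]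
    refine Finset.sum_congr rfl fun j _ => ?_
    rw [show (1 - ((1-z₁)/2 * X u + (1+z₁)/2 * z₂))/2 =
      ((1-z₁)/2)*((1-X u)/2) + ((1+z₁)/2)*((1-z₂)/2) by ring, add_pow, Finset.mul_sum, Finset.mul_sum, Finset.sum_mul]
    refine Finset.sum_congr rfl fun k hk => ?_
    have hkj : k ≤ j := by simpa [Nat.lt_succ_iff] using hk
    simp only [hf, hg, hh]
    rw [Nat.add_sub_cancel' hkj, mul_pow, mul_pow]
    ring
  rw [hval, hfun]
  exact Nice.sum _ fun m _ => Nice.sum _ fun k _ => Nice.sum _ fun l _ => Nice.prod (fi k l) (gi l) (hi k) _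

end Helpers

/-- for `β > 0`, the reproducing kernel on the solid paraboloid is an
integral of the reproducing kernel on the parabolic domain. -/
theorem stmt17 (d : ℕ) (hd : 2 ≤ d) (β γ μ : ℝ) (hβ : 0 < β) (hμ : 0 < μ) (hγ : -1 < γ)
    (n : ℕ) (x : Euc d) (t : ℝ) (y : Euc d) (s : ℝ)
    (hxt : (x, t) ∈ Vset d) (hys : (y, s) ∈ Vset d) (ht : 0 < t) (hs : 0 < s) :
    PnW d β γ μ n x t y s =
      κβ d β μ * ∫ z₁ in (-1:ℝ)..1, ∫ z₂ in (-1:ℝ)..1, ∫ u in (-1:ℝ)..1,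
        PnU γ (β + μ + ((d : ℝ) - 1)/2) n (Real.sqrt t, t)
            (Real.sqrt s * ξW d x t y s z₁ z₂ u, s) *
          ((1 - z₁) ^ (μ + ((d : ℝ) - 1)/2) * (1 + z₁) ^ (β - 1) *
            (1 - z₂ ^ 2) ^ (β - 1/2) * (1 - u ^ 2) ^ (μ - 1)) := by
  
  have hd' : (2:ℝ) ≤ d := by exact_mod_cast hd
  set lam : ℝ := μ + ((d:ℝ)-1)/2 with hlam
  have hl : 0 < lam := by rw [hlam]; linarith
  have hα : β + μ + ((d:ℝ)-1)/2 = lam + β := by rw [hlam]; ring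
  rw [hα]
  have hsd : 0 < Real.sqrt s := Real.sqrt_pos.2 hs
  have htd : 0 < Real.sqrt t := Real.sqrt_pos.2 ht
  set c : ℕ → ℝ := fun m =>
      jacobiP (n - m) ((m : ℝ) + β + μ + ((d : ℝ) - 1) / 2) γ (1 - 2 * t) *
        jacobiP (n - m) ((m : ℝ) + β + μ + ((d : ℝ) - 1) / 2) γ (1 - 2 * s) / hW d β γ μ m n *
        (Real.sqrt t) ^ m * (Real.sqrt s) ^ m with hc
  have hU : ∀ w : ℝ, PnU γ (lam+β) n (Real.sqrt t, t) (Real.sqrt s * w, s)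
      = ∑ m ∈ Finset.range (n+1), c m * Zm (lam+β) m w := by
    intro w
    unfold PnU
    refine Finset.sum_congr rfl fun m _ => ?_
    rw [← jac_Z (by positivity : 0 < lam + β)]
    have e1 : (m:ℝ) + β + μ + ((d:ℝ)-1)/2 = lam + β + m := by rw [hlam]; ring
    simp only [PknU, hknU, hc, hW, e1, hα]
    rw [div_self htd.ne', mul_div_cancel_left₀ _ hsd.ne']
    simp only [div_eq_mul_inv, mul_inv]
    ring
  have hX : Continuous (xi0 d x t y s) := by
    unfold xi0; fun_prop
  have key := (Nice_core hl hβ hμ hX n c).eq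
  have k0 := (Nice_core hl hβ hμ hX 0 (fun _ => 1)).eq
  have hZ0 : ∀ (a w : ℝ), 0 < a → Zm a 0 w = 1 := by
    intro a w ha
    rw [Zm_eq ha]
    simp [zc, RH, poch_zero]
  have hlb : 0 < lam + β := by positivity
  simp only [zero_add, Finset.sum_range_one, one_mul, hZ0 _ _ hl, hZ0 _ _ hlb] at k0
  have hI1 : 0 < ∫ z in (-1:ℝ)..1, (1-z)^lam * (1+z)^(β-1) := by
    have := (mom2 (by positivity : 0 < lam+1) hβ).1
    simpa only [add_sub_cancel_right] using this
  have hI2 : 0 < ∫ z in (-1:ℝ)..1, (1-z^2)^(β-1/2) := by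
    have := (mom2 (by positivity : 0 < β+1/2) (by positivity : 0 < β+1/2)).1
    rw [show β + 1/2 - 1 = β - 1/2 by ring] at this
    rwa [intervalIntegral.integral_congr (fun z hz => sq_weight (β-1/2) hz)]
  have hL : PnW d β γ μ n x t y s = σμ μ * ∫ u in (-1:ℝ)..1,
      (∑ m ∈ Finset.range (n+1), c m * Zm lam m (xi0 d x t y s u)) * (1-u^2)^(μ-1) := rfl
  have hR : κβ d β μ = ((∫ z in (-1:ℝ)..1, (1-z)^lam * (1+z)^(β-1)) *
      (∫ z in (-1:ℝ)..1, (1-z^2)^(β-1/2)) * ∫ u in (-1:ℝ)..1, (1-u^2)^(μ-1))⁻¹ := by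
    rw [← k0]; rfl
  simp only [hU]
  rw [hL, hR]
  unfold ξW σμ
  rw [key]
  generalize (∫ z in (-1:ℝ)..1, (1-z)^lam * (1+z)^(β-1)) = A1 at *
  generalize (∫ z in (-1:ℝ)..1, (1-z^2)^(β-1/2)) = A2 at *
  rw [mul_inv, mul_inv]
  field_simp
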